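/- Let R > 0, let B_R = {x ∈ B : d(x) < R} (the hyperbolic ball of radius R centered at 0, equal to the Euclidean ball of radius tanh(R/2)), and let (8 - n)/3 < α < 2 with n > 2. Then for every φ ∈ C_c^∞(B_R ∖ {0}), ∫_{B_R} d^α λ^{-n} (div(λ^{n-2} ∇φ))² dx ≥ ((n - α)²/4) ∫_{B_R} d^{α-2} |∇φ|² λ^{n-2} dx + K ∫_{B_R} d^{α-2} (R - d)^{-2} φ² λ^n dx, where K = (n - α)(n + 3α - 8)/16. -/

import Mathlib

open MeasureTheory

/-- Conformal factor of the Poincaré ball model. -/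
noncomputable def lam {n : ℕ} (x : EuclideanSpace ℝ (Fin n)) : ℝ := 2 / (1 - ‖x‖ ^ 2)

/-- Hyperbolic distance to the origin in the Poincaré ball model. -/
noncomputable def dH {n : ℕ} (x : EuclideanSpace ℝ (Fin n)) : ℝ :=
  Real.log ((1 + ‖x‖) / (1 - ‖x‖))

/-- Euclidean divergence of a vector field on ℝⁿ. -/
noncomputable def dvg {n : ℕ} (V : EuclideanSpace ℝ (Fin n) → EuclideanSpace ℝ (Fin n))
    (x : EuclideanSpace ℝ (Fin n)) : ℝ :=
  ∑ i, fderiv ℝ V x (EuclideanSpace.single i 1) i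

/-- The hyperbolic ball of radius `R` about the origin in the Poincaré ball model. -/
noncomputable def hypBall (n : ℕ) (R : ℝ) : Set (EuclideanSpace ℝ (Fin n)) :=
  {x ∈ Metric.ball (0 : EuclideanSpace ℝ (Fin n)) 1 | dH x < R}

/-- The divergence of an integrable differentiable field with integrable derivative integrates
to zero. -/
lemma integral_dvg_eq_zero {n : ℕ} {V : EuclideanSpace ℝ (Fin n) → EuclideanSpace ℝ (Fin n)}
    (hV : Differentiable ℝ V) (hVi : Integrable V)
    (hV' : ∀ v, Integrable fun x => fderiv ℝ V x v) :
    ∫ x, dvg V x = 0 := by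
  have hcoord (v) (i : Fin n) : Integrable fun x => fderiv ℝ V x v i :=
    (EuclideanSpace.proj (𝕜 := ℝ) i).integrable_comp (hV' v)
  unfold dvg
  rw [integral_finsetSum _ fun i _ => hcoord _ i]
  refine Finset.sum_eq_zero fun i _ => ?_
  have hVc : Differentiable ℝ fun x => V x i :=
    (EuclideanSpace.proj (𝕜 := ℝ) i).differentiable.comp hV
  have hfd (x v) : fderiv ℝ (fun x => V x i) x v = fderiv ℝ V x v i := by
    have := ((EuclideanSpace.proj (𝕜 := ℝ) i).hasFDerivAt.comp x (hV x).hasFDerivAt).fderiv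
    exact congrArg (fun L => L v) this
  have key := integral_mul_fderiv_eq_neg_fderiv_mul_of_integrable (μ := volume)
    (f := fun _ : EuclideanSpace ℝ (Fin n) => (1 : ℝ)) (g := fun x => V x i)
    (v := EuclideanSpace.single i 1) (by simp)
    (by simpa [hfd] using hcoord (EuclideanSpace.single i 1) i)
    (by simpa using (EuclideanSpace.proj (𝕜 := ℝ) i).integrable_comp hVi)
    (fun x _ => differentiableAt_const _) (fun x _ => hVc x)
  simpa [hfd] using key

lemma sum_apply_single_mul {n : ℕ} (L : EuclideanSpace ℝ (Fin n) →L[ℝ] ℝ)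
    (w : EuclideanSpace ℝ (Fin n)) :
    ∑ i, L (EuclideanSpace.single i 1) * w i = L w := by
  conv_rhs => rw [← (EuclideanSpace.basisFun (Fin n) ℝ).sum_repr w]
  simp [map_sum, mul_comm]

lemma dvg_smul {n : ℕ} {f : EuclideanSpace ℝ (Fin n) → ℝ}
    {W : EuclideanSpace ℝ (Fin n) → EuclideanSpace ℝ (Fin n)} {x : EuclideanSpace ℝ (Fin n)}
    {f' : EuclideanSpace ℝ (Fin n) →L[ℝ] ℝ} (hf : HasFDerivAt f f' x)
    (hW : DifferentiableAt ℝ W x) :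
    dvg (fun y => f y • W y) x = f x * dvg W x + f' (W x) := by
  unfold dvg
  rw [(hf.fun_smul hW.hasFDerivAt).fderiv, ← sum_apply_single_mul f', Finset.mul_sum,
    ← Finset.sum_add_distrib]
  simp

lemma dvg_id {n : ℕ} (x : EuclideanSpace ℝ (Fin n)) : dvg (fun y => y) x = n := by
  simp [dvg]

lemma dvg_add {n : ℕ} {V W : EuclideanSpace ℝ (Fin n) → EuclideanSpace ℝ (Fin n)}
    {x : EuclideanSpace ℝ (Fin n)} (hV : DifferentiableAt ℝ V x) (hW : DifferentiableAt ℝ W x) :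
    dvg (fun y => V y + W y) x = dvg V x + dvg W x := by
  simp [dvg, fderiv_fun_add hV hW, Finset.sum_add_distrib]

lemma HasDerivAt.hasFDerivAt_comp_norm {E : Type*} [NormedAddCommGroup E] [InnerProductSpace ℝ E]
    {g : ℝ → ℝ} {g' : ℝ} {x : E} (hx : x ≠ 0) (hg : HasDerivAt g g' ‖x‖) :
    HasFDerivAt (fun y : E => g ‖y‖) ((g' / ‖x‖) • innerSL ℝ x) x := by
  have hx' : ‖x‖ ≠ 0 := norm_ne_zero_iff.2 hx
  have h1 : HasFDerivAt (fun y : E => √(‖y‖ ^ 2)) ((1 / (2 * √(‖x‖ ^ 2))) • (2 • innerSL ℝ x)) x :=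
    (hasStrictFDerivAt_norm_sq x).hasFDerivAt.sqrt (by positivity)
  simp only [Real.sqrt_sq (norm_nonneg _)] at h1
  convert! hg.comp_hasFDerivAt x h1 using 1
  ext v
  simp
  field_simp

lemma two_mul_le_log_div {r : ℝ} (h0 : 0 < r) (h1 : r < 1) :
    2 * r ≤ Real.log ((1 + r) / (1 - r)) := by
  rw [Real.log_div (by linarith) (by linarith)]
  have h := Real.hasSum_log_sub_log_of_abs_lt_one (abs_lt.2 ⟨by linarith, h1⟩)
  simpa using le_hasSum h 0 fun k _ => by positivity

lemma hasDerivAt_log_div {r : ℝ} (h0 : 0 < r) (h1 : r < 1) :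
    HasDerivAt (fun r : ℝ => Real.log ((1 + r) / (1 - r))) (2 / (1 - r ^ 2)) r := by
  have ha : (1 : ℝ) - r ≠ 0 := by linarith
  have hb : (1 : ℝ) + r ≠ 0 := by linarith
  have hc : (1 : ℝ) - r ^ 2 ≠ 0 := by nlinarith
  convert! (((hasDerivAt_id r).const_add 1).div ((hasDerivAt_id r).const_sub 1) ha).log
    (div_ne_zero hb ha) using 1
  simp
  field_simp
  ring

lemma hasDerivAt_two_div_one_sub_sq {r : ℝ} (h0 : 0 < r) (h1 : r < 1) :
    HasDerivAt (fun r : ℝ => 2 / (1 - r ^ 2)) ((2 / (1 - r ^ 2)) ^ 2 * r) r := by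
  have hc : (1 : ℝ) - r ^ 2 ≠ 0 := by nlinarith
  convert! (hasDerivAt_const r (2 : ℝ)).div (((hasDerivAt_id r).pow 2).const_sub 1) hc using 1
  simp
  field_simp

/-- Pointwise algebraic core: Young's inequality for the Laplacian term and a completed square for
the radial derivative. `S` is `s ^ (α - 4)`, `N` is `l ^ n`, `G` the Euclidean length of the
gradient and `B` its pairing with the position vector. -/
lemma rellich_pointwise {n α s t l r S N G B D u : ℝ} (_hn : 2 < n) (hα₁ : (8 - n) / 3 < α)
    (hα₂ : α < 2) (hs : 0 < s) (ht : 0 < t) (hl : 0 < l) (hr : 0 < r) (hS : 0 < S) (hN : 0 < N)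
    (hB : B ^ 2 ≤ r ^ 2 * G ^ 2) (hcoth : 1 ≤ s * (r + 1 / (l * r)))
    {e κ a m m' : ℝ} (he : e = (n + α - 4) * (n - α) / 8)
    (hκ : κ = (n - α) * (n + 3 * α - 8) / 4)
    (ha : a = 2 * e * (2 - α) + κ * ((n + α - 4) / 2))
    (hm : m = -(a * (S * s) + κ / 2 * (S * s ^ 2 / t)))
    (hm' : m' = -(a * ((α - 3) * S) + κ / 2 * ((α - 2) * (S * s) / t + S * s ^ 2 / t ^ 2))) :
    (n - α) ^ 2 / 4 * (S * s ^ 2 * G ^ 2 * (N / l ^ 2))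
      + (n - α) * (n + 3 * α - 8) / 16 * (S * s ^ 2 * (u ^ 2 / t ^ 2) * N)
      + (-4 * e * (S * s ^ 2) * u * D + (-4 * e * ((α - 2) * (S * s) * l) / r * (N / l ^ 2 * B) * u
          + -4 * e * (S * s ^ 2) * (N / l ^ 2 * G ^ 2))
        + (u ^ 2 * (N / l * m / r) * n + (2 * u * B * (N / l * m / r)
          + u ^ 2 * ((((n - 1) * (N / l ^ 2) * (l ^ 2 * r) * m + N / l * (m' * l)) / r
            - N / l * m / r ^ 2) * r))))
      ≤ S * s ^ 4 * (1 / N) * D ^ 2 := by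
  have hp : 0 < n - α := by linarith
  have hκ0 : 0 < κ := by rw [hκ]; have : 0 < n + 3 * α - 8 := by linarith
                         positivity
  have hh : 0 < n + α - 4 := by linarith
  have he0 : 0 < e := by rw [he]; positivity
  have ha0 : 0 < a := by
    have : 0 < 2 - α := by linarith
    rw [ha]; positivity
  have h1 : 0 ≤ S / N * (D * s ^ 2 + 2 * e * N * u) ^ 2 := by positivity
  have h2 : 0 ≤ κ * S * s ^ 2 * (N / l ^ 2) * (G ^ 2 - B ^ 2 / r ^ 2) := by
    have : B ^ 2 / r ^ 2 ≤ G ^ 2 := by rw [div_le_iff₀ (by positivity)]; linarith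
    have : 0 ≤ G ^ 2 - B ^ 2 / r ^ 2 := by linarith
    positivity
  have h3 : 0 ≤ κ * S * s ^ 2 * N *
      (B / (r * l) + ((n + α - 4) / 2 / s + 1 / (2 * t)) * u) ^ 2 := by positivity
  have h4 : 0 ≤ N * u ^ 2 * (a * (S * s) + κ / 2 * (S * s ^ 2 / t)) * (n - 1) / s *
      (s * (r + 1 / (l * r)) - 1) := by
    have : 0 ≤ s * (r + 1 / (l * r)) - 1 := by linarith
    have : 0 < n - 1 := by linarith
    positivity
  have h5 : 0 ≤ N * u ^ 2 * (κ / 2) * (S * s / t) := by positivity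
  rw [← sub_nonneg]
  have key := add_nonneg (add_nonneg (add_nonneg (add_nonneg h1 h2) h3) h4) h5
  refine key.trans_eq ?_
  subst hm hm' ha hκ he
  field_simp
  ring

/-- The radial profile of the vector field used against `φ ^ 2`. -/
noncomputable def hardyProfile (α R a κ s : ℝ) : ℝ :=
  -(a * s ^ (α - 3) + κ / 2 * (s ^ (α - 2) / (R - s)))

lemma hasDerivAt_hardyProfile (α R a κ : ℝ) {s : ℝ} (hs : 0 < s) (hsR : s < R) :
    HasDerivAt (hardyProfile α R a κ)
      (-(a * ((α - 3) * s ^ (α - 4)) + κ / 2 * ((α - 2) * (s ^ (α - 4) * s) / (R - s)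
        + s ^ (α - 4) * s ^ 2 / (R - s) ^ 2))) s := by
  have ht : R - s ≠ 0 := by linarith
  have h (p : ℝ) : HasDerivAt (fun s : ℝ => s ^ p) (p * s ^ (p - 1)) s :=
    Real.hasDerivAt_rpow_const (Or.inl hs.ne')
  have e3 : s ^ (α - 2 - 1) = s ^ (α - 4) * s := by
    rw [← Real.rpow_add_one hs.ne']; ring_nf
  have e2 : s ^ (α - 2) = s ^ (α - 4) * s ^ 2 := by
    rw [← Real.rpow_two, ← Real.rpow_add hs]; ring_nf
  have e4 : s ^ (α - 3 - 1) = s ^ (α - 4) := by ring_nf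
  have := (((h (α - 3)).const_mul a).add
    (((h (α - 2)).div ((hasDerivAt_id s).const_sub R) ht).const_mul (κ / 2))).neg
  convert! this using 1
  rw [e2, e3, e4]
  simp only [id]
  field_simp
  ring

/-- The vector field whose divergence links the two sides of the Rellich inequality. -/
noncomputable def rellichField {n : ℕ} (α R e a κ : ℝ) (φ : EuclideanSpace ℝ (Fin n) → ℝ)
    (y : EuclideanSpace ℝ (Fin n)) : EuclideanSpace ℝ (Fin n) :=
  (-4 * e * dH y ^ (α - 2) * φ y) • (lam y ^ ((n : ℝ) - 2) • gradient φ y) +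
    (φ y ^ 2 * (lam y ^ ((n : ℝ) - 1) * hardyProfile α R a κ (dH y) / ‖y‖)) • y

lemma dvg_rellichField {n : ℕ} {α R : ℝ} (e a κ : ℝ) {φ : EuclideanSpace ℝ (Fin n) → ℝ}
    {x : EuclideanSpace ℝ (Fin n)} (hφ : DifferentiableAt ℝ φ x) (hx : x ≠ 0) (hx1 : ‖x‖ < 1)
    (hd0 : 0 < dH x) (hdR : dH x < R)
    (hW : DifferentiableAt ℝ (fun y => lam y ^ ((n : ℝ) - 2) • gradient φ y) x)
    {S N l r m m' s B G D : ℝ} (hS : S = dH x ^ (α - 4)) (hN : N = lam x ^ (n : ℝ))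
    (hl : l = lam x) (hr : r = ‖x‖) (hs : s = dH x)
    (hm : m = -(a * (S * s) + κ / 2 * (S * s ^ 2 / (R - s))))
    (hm' : m' = -(a * ((α - 3) * S) +
      κ / 2 * ((α - 2) * (S * s) / (R - s) + S * s ^ 2 / (R - s) ^ 2)))
    (hB : B = fderiv ℝ φ x x) (hG : G = ‖gradient φ x‖)
    (hD : D = dvg (fun y => lam y ^ ((n : ℝ) - 2) • gradient φ y) x) :
    dvg (rellichField α R e a κ φ) x =
      -4 * e * (S * s ^ 2) * φ x * D +
        (-4 * e * ((α - 2) * (S * s) * l) / r * (N / l ^ 2 * B) * φ x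
          + -4 * e * (S * s ^ 2) * (N / l ^ 2 * G ^ 2))
        + (φ x ^ 2 * (N / l * m / r) * n + (2 * φ x * B * (N / l * m / r)
          + φ x ^ 2 * ((((n - 1) * (N / l ^ 2) * (l ^ 2 * r) * m + N / l * (m' * l)) / r
            - N / l * m / r ^ 2) * r))) := by
  have hr0 : 0 < ‖x‖ := norm_pos_iff.2 hx
  have hl0 : 0 < lam x := div_pos two_pos (by nlinarith)
  have hs0 : 0 < s := hs ▸ hd0
  have e2 : dH x ^ (α - 2) = S * s ^ 2 := by
    rw [hS, hs, ← Real.rpow_two, ← Real.rpow_add hd0]; ring_nf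
  have e3 : dH x ^ (α - 3) = S * s := by
    rw [hS, hs, ← Real.rpow_add_one hd0.ne']; ring_nf
  have e3' : dH x ^ (α - 2 - 1) = S * s := by rw [← e3]; ring_nf
  have n1 : lam x ^ ((n : ℝ) - 1) = N / l := by rw [hN, hl, Real.rpow_sub_one hl0.ne']
  have n2 : lam x ^ ((n : ℝ) - 2) = N / l ^ 2 := by
    rw [hN, hl, Real.rpow_sub hl0, Real.rpow_two]
  have n2' : lam x ^ ((n : ℝ) - 1 - 1) = N / l ^ 2 := by rw [← n2]; ring_nf
  have em : hardyProfile α R a κ (dH x) = m := by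
    rw [hardyProfile, e2, e3, hm, hs]
  have ds : HasDerivAt (fun r : ℝ => Real.log ((1 + r) / (1 - r))) l ‖x‖ := by
    rw [hl]; exact hasDerivAt_log_div hr0 hx1
  have dl : HasDerivAt (fun r : ℝ => 2 / (1 - r ^ 2)) (l ^ 2 * r) ‖x‖ := by
    rw [hl, hr]; exact hasDerivAt_two_div_one_sub_sq hr0 hx1
  have dm : HasDerivAt (hardyProfile α R a κ) m' (Real.log ((1 + ‖x‖) / (1 - ‖x‖))) := by
    have := hasDerivAt_hardyProfile α R a κ hd0 hdR
    rw [hm', hS, hs]; exact this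
  have dmc : HasDerivAt (fun r : ℝ => hardyProfile α R a κ (Real.log ((1 + r) / (1 - r))))
      (m' * l) ‖x‖ := HasDerivAt.comp (h₂ := hardyProfile α R a κ) ‖x‖ dm ds
  have hφ' := hφ.hasFDerivAt
  have df : HasFDerivAt (fun y : EuclideanSpace ℝ (Fin n) => -4 * e * dH y ^ (α - 2) * φ y) _ x :=
    (((ds.rpow_const (p := α - 2) (Or.inl hd0.ne')).const_mul (-4 * e)).hasFDerivAt_comp_norm
      hx).mul hφ'
  have dk : HasFDerivAt (fun y : EuclideanSpace ℝ (Fin n) =>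
      φ y ^ 2 * (lam y ^ ((n : ℝ) - 1) * hardyProfile α R a κ (dH y) / ‖y‖)) _ x :=
    (hφ'.pow 2).mul ((((dl.rpow_const (p := (n : ℝ) - 1) (Or.inl hl0.ne')).mul dmc).div
      (hasDerivAt_id ‖x‖) hr0.ne').hasFDerivAt_comp_norm hx)
  unfold rellichField
  rw [dvg_add (df.differentiableAt.fun_smul hW)
      (dk.differentiableAt.fun_smul differentiableAt_fun_id),
    dvg_smul df hW, dvg_smul dk differentiableAt_fun_id, dvg_id]
  have hBx : inner ℝ x (gradient φ x) = B := by rw [hB, inner_gradient_right]; simp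
  have hGx : fderiv ℝ φ x (gradient φ x) = G ^ 2 := by
    rw [← inner_gradient_left, hG, real_inner_self_eq_norm_sq]
  have es : Real.log ((1 + ‖x‖) / (1 - ‖x‖)) = dH x := rfl
  have el : 2 / (1 - ‖x‖ ^ 2) = lam x := rfl
  rw [← hr] at hr0
  rw [← hl] at hl0
  simp only [add_apply, smul_apply, smul_eq_mul, innerSL_apply_apply, map_smul,
    hBx, hGx, ← hB, ← hD, es, el, e2, e3', n1, n2, n2', em, real_inner_self_eq_norm_sq,
    nsmul_eq_mul, Pi.mul_apply, id]
  rw [← hr]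
  push_cast
  field_simp
  ring

lemma integrable_of_continuousOn_of_eq_zero {E F : Type*} [NormedAddCommGroup E]
    [MeasureSpace E] [BorelSpace E] [IsFiniteMeasureOnCompacts (volume : Measure E)]
    [NormedAddCommGroup F] {K U : Set E} {f : E → F} (hK : IsCompact K) (hKU : K ⊆ U)
    (hf : ContinuousOn f U) (h0 : ∀ x ∉ K, f x = 0) : Integrable f :=
  (integrableOn_iff_integrable_of_support_subset fun x hx => by_contra fun h => hx (h0 x h)).1
    ((hf.mono hKU).integrableOn_compact hK)

section PuncturedBall

variable {n : ℕ} {R : ℝ}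

lemma dH_pos {x : EuclideanSpace ℝ (Fin n)} (hx : x ≠ 0) (hx1 : ‖x‖ < 1) : 0 < dH x :=
  lt_of_lt_of_le (by have := norm_pos_iff.2 hx; linarith)
    (two_mul_le_log_div (norm_pos_iff.2 hx) hx1)

lemma lam_pos {x : EuclideanSpace ℝ (Fin n)} (hx1 : ‖x‖ < 1) : 0 < lam x :=
  div_pos two_pos (by nlinarith [norm_nonneg x])

lemma isOpen_hypBall (n : ℕ) (R : ℝ) : IsOpen (hypBall n R) := by
  have : ContinuousOn (dH (n := n)) (Metric.ball 0 1) := by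
    unfold dH
    intro x hx
    have hx1 : ‖x‖ < 1 := by simpa using hx
    have h1 : 1 - ‖x‖ ≠ 0 := by linarith
    have h2 : (1 + ‖x‖) / (1 - ‖x‖) ≠ 0 :=
      div_ne_zero (by linarith [norm_nonneg x]) h1
    exact (((continuousAt_const.add continuous_norm.continuousAt).div
      (continuousAt_const.sub continuous_norm.continuousAt) h1).log h2).continuousWithinAt
  exact this.isOpen_inter_preimage Metric.isOpen_ball isOpen_Iio

lemma contDiffAt_dH {x : EuclideanSpace ℝ (Fin n)} (hx : x ≠ 0) (hx1 : ‖x‖ < 1) :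
    ContDiffAt ℝ 1 dH x := by
  have h1 : 1 - ‖x‖ ≠ 0 := by linarith
  exact ((contDiffAt_const.add (contDiffAt_norm ℝ hx)).div
    (contDiffAt_const.sub (contDiffAt_norm ℝ hx)) h1).log
    (div_ne_zero (by linarith [norm_nonneg x]) h1)

lemma contDiffAt_lam {x : EuclideanSpace ℝ (Fin n)} (hx1 : ‖x‖ < 1) :
    ContDiffAt ℝ 1 lam x :=
  contDiffAt_const.div (contDiffAt_const.sub (contDiff_norm_sq ℝ).contDiffAt)
    (by nlinarith [norm_nonneg x])

lemma contDiff_gradient {φ : EuclideanSpace ℝ (Fin n) → ℝ} (hφ : ContDiff ℝ (⊤ : ℕ∞) φ) :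
    ContDiff ℝ 1 (gradient φ) :=
  (InnerProductSpace.toDual ℝ (EuclideanSpace ℝ (Fin n))).symm.contDiff.comp
    ((hφ.fderiv_right (m := (⊤ : ℕ∞)) (by simp)).of_le (by exact_mod_cast le_top))

lemma contDiffAt_lam_rpow_smul_gradient {φ : EuclideanSpace ℝ (Fin n) → ℝ}
    (hφ : ContDiff ℝ (⊤ : ℕ∞) φ) {x : EuclideanSpace ℝ (Fin n)} (hx1 : ‖x‖ < 1) (p : ℝ) :
    ContDiffAt ℝ 1 (fun y => lam y ^ p • gradient φ y) x :=
  ((contDiffAt_lam hx1).rpow_const_of_ne (lam_pos hx1).ne').smul (contDiff_gradient hφ).contDiffAt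

lemma contDiffAt_rellichField {φ : EuclideanSpace ℝ (Fin n) → ℝ} (hφ : ContDiff ℝ (⊤ : ℕ∞) φ)
    {x : EuclideanSpace ℝ (Fin n)} (hx : x ≠ 0) (hx1 : ‖x‖ < 1) (hdR : dH x < R)
    (α e a κ : ℝ) : ContDiffAt ℝ 1 (rellichField α R e a κ φ) x := by
  have hd := contDiffAt_dH hx hx1
  have hd0 := (dH_pos hx hx1).ne'
  have hφ1 : ContDiffAt ℝ 1 φ x := (hφ.of_le (by exact_mod_cast le_top)).contDiffAt
  have hl := contDiffAt_lam hx1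
  have hp : ContDiffAt ℝ 1 (fun y => hardyProfile α R a κ (dH y)) x :=
    ((contDiffAt_const.mul (hd.rpow_const_of_ne hd0)).add
      (contDiffAt_const.mul ((hd.rpow_const_of_ne hd0).div (contDiffAt_const.sub hd)
        (by linarith)))).neg
  exact (((contDiffAt_const.mul (hd.rpow_const_of_ne hd0)).mul hφ1).smul
    (contDiffAt_lam_rpow_smul_gradient hφ hx1 _)).add
    (((hφ1.pow 2).mul (((hl.rpow_const_of_ne (lam_pos hx1).ne').mul hp).div
      (contDiffAt_norm ℝ hx) (norm_ne_zero_iff.2 hx))).smul contDiffAt_id)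

lemma continuousOn_dvg {V : EuclideanSpace ℝ (Fin n) → EuclideanSpace ℝ (Fin n)}
    {U : Set (EuclideanSpace ℝ (Fin n))} (hU : IsOpen U) (hV : ∀ x ∈ U, ContDiffAt ℝ 1 V x) :
    ContinuousOn (dvg V) U := by
  have h : ContinuousOn (fderiv ℝ V) U :=
    ContDiffOn.continuousOn_fderiv_of_isOpen (fun x hx => (hV x hx).contDiffWithinAt) hU le_rfl
  unfold dvg
  refine continuousOn_finsetSum _ fun i _ => ?_
  exact (EuclideanSpace.proj (𝕜 := ℝ) i).continuous.comp_continuousOn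
    (h.clm_apply continuousOn_const)

lemma rellichField_dvg_bound (hn : 2 < n) {α : ℝ} (hα₁ : (8 - (n : ℝ)) / 3 < α) (hα₂ : α < 2)
    {φ : EuclideanSpace ℝ (Fin n) → ℝ} (hφ : ContDiff ℝ (⊤ : ℕ∞) φ)
    {x : EuclideanSpace ℝ (Fin n)} (hx : x ≠ 0) (hx1 : ‖x‖ < 1) (hdR : dH x < R)
    {e κ a : ℝ} (he : e = (n + α - 4) * (n - α) / 8)
    (hκ : κ = (n - α) * (n + 3 * α - 8) / 4)
    (ha : a = 2 * e * (2 - α) + κ * ((n + α - 4) / 2)) :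
    ((n : ℝ) - α) ^ 2 / 4 * (dH x ^ (α - 2) * ‖gradient φ x‖ ^ 2 * lam x ^ ((n : ℝ) - 2)) +
      ((n : ℝ) - α) * ((n : ℝ) + 3 * α - 8) / 16 *
        (dH x ^ (α - 2) * (φ x ^ 2 / (R - dH x) ^ 2) * lam x ^ (n : ℝ)) +
      dvg (rellichField α R e a κ φ) x ≤
      dH x ^ α * lam x ^ (-(n : ℝ)) *
        (dvg (fun y => lam y ^ ((n : ℝ) - 2) • gradient φ y) x) ^ 2 := by
  have hr0 : 0 < ‖x‖ := norm_pos_iff.2 hx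
  have hd0 : 0 < dH x := dH_pos hx hx1
  have hl0 : 0 < lam x := lam_pos hx1
  rw [dvg_rellichField e a κ ((hφ.differentiable (by simp)) x) hx hx1 hd0 hdR
    ((contDiffAt_lam_rpow_smul_gradient hφ hx1 _).differentiableAt one_ne_zero)
    rfl rfl rfl rfl rfl rfl rfl rfl rfl rfl]
  have e2 : dH x ^ (α - 2) = dH x ^ (α - 4) * dH x ^ 2 := by
    rw [← Real.rpow_two, ← Real.rpow_add hd0]; ring_nf
  have e0 : dH x ^ α = dH x ^ (α - 4) * dH x ^ 4 := by
    rw [← Real.rpow_natCast, ← Real.rpow_add hd0]; norm_num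
  have n2 : lam x ^ ((n : ℝ) - 2) = lam x ^ (n : ℝ) / lam x ^ 2 := by
    rw [Real.rpow_sub hl0, Real.rpow_two]
  rw [e2, e0, n2, Real.rpow_neg hl0.le, ← one_div]
  refine rellich_pointwise (by exact_mod_cast hn) hα₁ hα₂ hd0 (sub_pos.2 hdR) hl0 hr0
    (Real.rpow_pos_of_pos hd0 _) (Real.rpow_pos_of_pos hl0 _) ?_ ?_ he hκ ha rfl rfl
  · rw [← inner_gradient_left, ← mul_pow, mul_comm, sq_le_sq, abs_mul, abs_norm, abs_norm]
    exact abs_real_inner_le_norm _ _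
  · have h := two_mul_le_log_div hr0 hx1
    have hc : ‖x‖ + 1 / (lam x * ‖x‖) = (1 + ‖x‖ ^ 2) / (2 * ‖x‖) := by
      have : 1 - ‖x‖ ^ 2 ≠ 0 := by nlinarith
      unfold lam
      field_simp
      ring
    rw [hc, mul_div_assoc', le_div_iff₀ (by positivity)]
    have : 2 * ‖x‖ ≤ dH x := h
    nlinarith [mul_nonneg hd0.le (sq_nonneg ‖x‖)]

end PuncturedBall

/-- Improved Rellich inequality on a hyperbolic ball with distance-to-boundary
remainder (Corollary 3.2). -/
theorem improved_rellich_hyperbolic_ball {n : ℕ} (hn : 2 < n) (R : ℝ) (hR : 0 < R)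
    (α : ℝ) (hα₁ : (8 - (n : ℝ)) / 3 < α) (hα₂ : α < 2)
    (φ : EuclideanSpace ℝ (Fin n) → ℝ)
    (hφ_smooth : ContDiff ℝ (⊤ : ℕ∞) φ) (hφ_cpt : HasCompactSupport φ)
    (hφ_supp : tsupport φ ⊆ hypBall n R \ {0}) :
    ((n : ℝ) - α) ^ 2 / 4 *
          (∫ x in hypBall n R, dH x ^ (α - 2) * ‖gradient φ x‖ ^ 2 * lam x ^ ((n : ℝ) - 2)) +
        ((n : ℝ) - α) * ((n : ℝ) + 3 * α - 8) / 16 *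
          ∫ x in hypBall n R, dH x ^ (α - 2) * (φ x ^ 2 / (R - dH x) ^ 2) * lam x ^ (n : ℝ) ≤
      ∫ x in hypBall n R, dH x ^ α * lam x ^ (-(n : ℝ)) *
        (dvg (fun y => lam y ^ ((n : ℝ) - 2) • gradient φ y) x) ^ 2 := by
  set e : ℝ := (n + α - 4) * (n - α) / 8 with he
  set κ : ℝ := (n - α) * (n + 3 * α - 8) / 4 with hκ
  set a : ℝ := 2 * e * (2 - α) + κ * ((n + α - 4) / 2) with ha
  set U := hypBall n R \ {0}
  have hU : IsOpen U := (isOpen_hypBall n R).sdiff isClosed_singleton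
  have hU0 : ∀ x ∈ U, x ≠ 0 := fun x hx => hx.2
  have hU1 : ∀ x ∈ U, ‖x‖ < 1 := fun x hx => by simpa using hx.1.1
  have hUR : ∀ x ∈ U, dH x < R := fun x hx => hx.1.2
  have hφ0 : ∀ x ∉ tsupport φ, φ =ᶠ[nhds x] fun _ => 0 :=
    fun x hx => notMem_tsupport_iff_eventuallyEq.1 hx
  have hg0 : ∀ x ∉ tsupport φ, gradient φ =ᶠ[nhds x] fun _ => 0 := fun x hx => by
    filter_upwards [(hφ0 x hx).fderiv (𝕜 := ℝ)] with y hy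
    simp [gradient, hy]
  have hW0 : ∀ x ∉ tsupport φ, dvg (fun y => lam y ^ ((n : ℝ) - 2) • gradient φ y) x = 0 :=
    fun x hx => by
      have : (fun y => lam y ^ ((n : ℝ) - 2) • gradient φ y) =ᶠ[nhds x] fun _ => 0 := by
        filter_upwards [hg0 x hx] with y hy
        simp [hy]
      simp [dvg, this.fderiv_eq]
  have hV0 : ∀ x ∉ tsupport φ, rellichField α R e a κ φ =ᶠ[nhds x] fun _ => 0 := fun x hx => by
    filter_upwards [hφ0 x hx] with y hy
    simp [rellichField, hy]
  have hV0' : ∀ x ∉ tsupport φ, fderiv ℝ (rellichField α R e a κ φ) x = 0 := fun x hx => by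
    simp [(hV0 x hx).fderiv_eq]
  have hV0'' : ∀ x ∉ tsupport φ, dvg (rellichField α R e a κ φ) x = 0 := fun x hx => by
    simp [dvg, hV0' x hx]
  have hVU : ∀ x ∈ U, ContDiffAt ℝ 1 (rellichField α R e a κ φ) x := fun x hx =>
    contDiffAt_rellichField hφ_smooth (hU0 x hx) (hU1 x hx) (hUR x hx) α e a κ
  have hWU : ∀ x ∈ U, ContDiffAt ℝ 1 (fun y => lam y ^ ((n : ℝ) - 2) • gradient φ y) x :=
    fun x hx => contDiffAt_lam_rpow_smul_gradient hφ_smooth (hU1 x hx) _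
  have cd (p : ℝ) : ContinuousOn (fun x : EuclideanSpace ℝ (Fin n) => dH x ^ p) U := fun x hx =>
    ((contDiffAt_dH (hU0 x hx) (hU1 x hx)).rpow_const_of_ne
      (dH_pos (hU0 x hx) (hU1 x hx)).ne').continuousAt.continuousWithinAt
  have cl (p : ℝ) : ContinuousOn (fun x : EuclideanSpace ℝ (Fin n) => lam x ^ p) U := fun x hx =>
    ((contDiffAt_lam (hU1 x hx)).rpow_const_of_ne
      (lam_pos (hU1 x hx)).ne').continuousAt.continuousWithinAt
  have cd1 : ContinuousOn (fun x : EuclideanSpace ℝ (Fin n) => dH x) U := by simpa using cd 1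
  have cg : ContinuousOn (gradient φ) U := (contDiff_gradient hφ_smooth).continuous.continuousOn
  have integrable_of {F : Type} [NormedAddCommGroup F] {f : EuclideanSpace ℝ (Fin n) → F}
      (hf : ContinuousOn f U) (h0 : ∀ x ∉ tsupport φ, f x = 0) : Integrable f :=
    integrable_of_continuousOn_of_eq_zero hφ_cpt hφ_supp hf h0
  have i1 : Integrable fun x => dH x ^ (α - 2) * ‖gradient φ x‖ ^ 2 * lam x ^ ((n : ℝ) - 2) :=
    integrable_of (((cd _).mul (cg.norm.pow 2)).mul (cl _)) fun x hx => by simp [(hg0 x hx).self_of_nhds]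
  have i2 : Integrable fun x =>
      dH x ^ (α - 2) * (φ x ^ 2 / (R - dH x) ^ 2) * lam x ^ (n : ℝ) :=
    integrable_of (((cd _).mul ((hφ_smooth.continuous.continuousOn.pow 2).div
      ((continuousOn_const.sub cd1).pow 2)
      fun x hx => pow_ne_zero 2 (sub_pos.2 (hUR x hx)).ne')).mul (cl _))
      fun x hx => by simp [(hφ0 x hx).self_of_nhds]
  have i3 : Integrable fun x => dH x ^ α * lam x ^ (-(n : ℝ)) *
      (dvg (fun y => lam y ^ ((n : ℝ) - 2) • gradient φ y) x) ^ 2 :=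
    integrable_of (((cd _).mul (cl _)).mul ((continuousOn_dvg hU hWU).pow 2))
      fun x hx => by simp [hW0 x hx]
  have i4 : Integrable (dvg (rellichField α R e a κ φ)) := integrable_of (continuousOn_dvg hU hVU) hV0''
  have hdiv : ∫ x in hypBall n R, dvg (rellichField α R e a κ φ) x = 0 := by
    rw [setIntegral_eq_integral_of_forall_compl_eq_zero fun x hx =>
      hV0'' x fun h => hx (hφ_supp h).1]
    refine integral_dvg_eq_zero (fun x => ?_)
      (integrable_of (fun x hx => (hVU x hx).continuousAt.continuousWithinAt)
        fun x hx => (hV0 x hx).self_of_nhds)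
      fun v => integrable_of (ContinuousOn.clm_apply (ContDiffOn.continuousOn_fderiv_of_isOpen
        (fun x hx => (hVU x hx).contDiffWithinAt) hU le_rfl) continuousOn_const)
        fun x hx => by simp [hV0' x hx]
    by_cases hx : x ∈ tsupport φ
    · exact (hVU x (hφ_supp hx)).differentiableAt one_ne_zero
    · exact (differentiableAt_const 0).congr_of_eventuallyEq (hV0 x hx)
  rw [← integral_const_mul, ← integral_const_mul, ← integral_add (i1.const_mul _).integrableOn
    (i2.const_mul _).integrableOn, ← add_zero (∫ x in hypBall n R, _), ← hdiv,
    ← integral_add ((i1.const_mul _).fun_add (i2.const_mul _)).integrableOn i4.integrableOn]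
  refine integral_mono (((i1.const_mul _).add (i2.const_mul _)).add i4).integrableOn
    i3.integrableOn fun x => ?_
  by_cases hx : x ∈ tsupport φ
  · have hxU := hφ_supp hx
    exact rellichField_dvg_bound hn hα₁ hα₂ hφ_smooth (hU0 x hxU) (hU1 x hxU) (hUR x hxU) he hκ ha
  · simp [hV0'' x hx, hW0 x hx, (hg0 x hx).self_of_nhds, (hφ0 x hx).self_of_nhds]
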